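/- For every fair division instance with n ≥ 1 agents having scaled (v_i([m]) = 1) monotone subadditive valuations, there exists an EF1 allocation whose social welfare is at least OPT/(16√n), where OPT is the maximum social welfare over all allocations. Consequently, the price of EF1 for scaled subadditive valuations is O(√n). -/

import Mathlib

open Finset

variable {ι α : Type*}

/-- Envy-freeness up to one good, for possibly partial allocations. -/
def IsEF1 [DecidableEq α] (v : ι → Finset α → ℝ) (A : ι → Finset α) : Prop :=
  ∀ i j, (A j).Nonempty → ∃ g ∈ A j, v i (A j \ {g}) ≤ v i (A i)

/-- `S` consists of consecutive elements of a single block `W j`. -/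
def IsSegment [LT α] (W : ι → Finset α) (j : ι) (S : Finset α) : Prop :=
  S ⊆ W j ∧ ∀ x ∈ S, ∀ z ∈ S, ∀ y ∈ W j, x < y → y < z → y ∈ S

lemma apply_biUnion_le_sum [DecidableEq ι] [DecidableEq α] {f : Finset α → ℝ} (h0 : f ∅ = 0)
    (hsub : ∀ A B, f (A ∪ B) ≤ f A + f B) (s : Finset ι) (A : ι → Finset α) :
    f (s.biUnion A) ≤ ∑ i ∈ s, f (A i) := by
  induction s using Finset.induction_on with
  | empty => simp [h0]
  | insert a s ha ih =>
    rw [Finset.biUnion_insert, Finset.sum_insert ha]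
    linarith [hsub (A a) (s.biUnion A)]

lemma IsEF1.of_improvement [DecidableEq α] {v : ι → Finset α → ℝ} {A B : ι → Finset α}
    (hA : IsEF1 v A) (hle : ∀ i, v i (A i) ≤ v i (B i))
    (hB : ∀ j, (∃ k, B j = A k) ∨ ∃ g ∈ B j, ∀ i, v i (B j \ {g}) ≤ v i (A i)) :
    IsEF1 v B := by
  intro i j hj
  obtain ⟨k, hk⟩ | ⟨g, hg, h⟩ := hB j
  · rw [hk] at hj ⊢
    obtain ⟨g, hg, h⟩ := hA i k hj
    exact ⟨g, hg, h.trans (hle i)⟩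
  · exact ⟨g, hg, (h i).trans (hle i)⟩

/-- If everyone is envied, then permuting the bundles along envy cycles strictly improves
the social welfare. -/
lemma exists_perm_improvement [Fintype ι] [Nonempty ι] (v : ι → Finset α → ℝ) (A : ι → Finset α)
    (henvy : ∀ j, ∃ i, v i (A i) < v i (A j)) :
    ∃ σ : Equiv.Perm ι, (∀ i, v i (A i) ≤ v i (A (σ i))) ∧
      ∑ i, v i (A i) < ∑ i, v i (A (σ i)) := by
  classical
  choose f hf using henvy
  let P := Function.periodicPts f
  have hbij : Set.BijOn f P P := Function.bijOn_periodicPts f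
  have hPne : P.Nonempty := by
    let i₀ : ι := Classical.arbitrary ι
    obtain ⟨a, b, hab, h⟩ := Finite.exists_ne_map_eq_of_infinite fun k : ℕ => f^[k] i₀
    wlog hlt : a < b generalizing a b
    · exact this b a hab.symm h.symm (lt_of_le_of_ne (not_lt.1 hlt) hab.symm)
    refine ⟨f^[a] i₀, Function.mk_mem_periodicPts (n := b - a) (by omega) ?_⟩
    change f^[b - a] (f^[a] i₀) = f^[a] i₀
    rw [← Function.iterate_add_apply, Nat.sub_add_cancel hlt.le]
    exact h.symm
  have hinj : Function.Injective fun i => if i ∈ P then f i else i := by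
    intro a b h
    by_cases ha : a ∈ P <;> by_cases hb : b ∈ P <;> simp only [ha, hb, if_true, if_false] at h
    · exact hbij.injOn ha hb h
    · exact absurd (h ▸ hbij.mapsTo ha) hb
    · exact absurd (h ▸ hbij.mapsTo hb) ha
    · exact h
  let τ : Equiv.Perm ι := Equiv.ofBijective _ (Finite.injective_iff_bijective.1 hinj)
  have hτ : ∀ i, τ i = if i ∈ P then f i else i := fun i => rfl
  have hle : ∀ i, v (τ i) (A (τ i)) ≤ v (τ i) (A i) := by
    intro i
    rw [hτ]
    split_ifs
    · exact (hf i).le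
    · exact le_rfl
  have hle' : ∀ i, v i (A i) ≤ v i (A (τ.symm i)) := fun i => by
    simpa using hle (τ.symm i)
  refine ⟨τ.symm, hle', Finset.sum_lt_sum (fun i _ => hle' i) ?_⟩
  obtain ⟨i, hi⟩ := hPne
  refine ⟨τ i, Finset.mem_univ _, ?_⟩
  rw [Equiv.symm_apply_apply, hτ, if_pos hi]
  exact hf i

/-- A partial EF1 allocation extends, by envy cycle elimination, to a complete one without
loss of social welfare. -/
lemma IsEF1.exists_complete [Fintype ι] [Nonempty ι] [Fintype α] [DecidableEq α]
    {v : ι → Finset α → ℝ} (hmono : ∀ i, Monotone (v i)) {P : ι → Finset α}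
    (hdisj : Pairwise fun a b => Disjoint (P a) (P b)) (hP : IsEF1 v P) :
    ∃ A : ι → Finset α, (Pairwise fun a b => Disjoint (A a) (A b)) ∧
      Finset.univ.biUnion A = Finset.univ ∧ IsEF1 v A ∧
      ∑ i, v i (P i) ≤ ∑ i, v i (A i) := by
  classical
  obtain ⟨A, hA, hmax⟩ := Finset.exists_max_image
    (Finset.univ.filter fun A : ι → Finset α => (Pairwise fun a b => Disjoint (A a) (A b)) ∧
      IsEF1 v A ∧ ∑ i, v i (P i) ≤ ∑ i, v i (A i))
    (fun A => toLex (∑ i, (A i).card, ∑ i, v i (A i))) ⟨P, by simp [hdisj, hP]⟩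
  simp only [Finset.mem_filter, Finset.mem_univ, true_and] at hA hmax
  obtain ⟨hd, hE, hw⟩ := hA
  refine ⟨A, hd, ?_, hE, hw⟩
  by_contra hne
  obtain ⟨g, hg⟩ : ∃ g, ∀ i, g ∉ A i := by
    simpa [Finset.eq_univ_iff_forall] using hne
  by_cases henvy : ∀ j, ∃ i, v i (A i) < v i (A j)
  · obtain ⟨σ, hle, hlt⟩ := exists_perm_improvement v A henvy
    have := hmax (fun i => A (σ i)) ⟨fun a b hab => hd (σ.injective.ne hab),
      hE.of_improvement hle fun j => Or.inl ⟨_, rfl⟩, hw.trans hlt.le⟩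
    rw [Prod.Lex.toLex_le_toLex, Equiv.sum_comp σ fun i => (A i).card] at this
    simp only [lt_irrefl, true_and, false_or] at this
    exact this.not_gt hlt
  · push Not at henvy
    obtain ⟨j, hj⟩ := henvy
    let B := Function.update A j (insert g (A j))
    have hBj : B j = insert g (A j) := Function.update_self ..
    have hBk : ∀ k, k ≠ j → B k = A k := fun k hk => Function.update_of_ne hk ..
    have hsub : ∀ i, A i ⊆ B i := by
      intro i
      by_cases h : i = j
      · subst h; rw [hBj]; exact Finset.subset_insert _ _
      · rw [hBk i h]
    have hle : ∀ i, v i (A i) ≤ v i (B i) := fun i => hmono i (hsub i)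
    have hdB : Pairwise fun a b => Disjoint (B a) (B b) := by
      intro a b hab
      by_cases ha : a = j
      · subst ha
        rw [hBj, hBk b hab.symm, Finset.disjoint_insert_left]
        exact ⟨hg b, hd hab⟩
      · rw [hBk a ha]
        by_cases hb : b = j
        · subst hb
          rw [hBj, Finset.disjoint_insert_right]
          exact ⟨hg a, hd hab⟩
        · rw [hBk b hb]; exact hd hab
    have hEB : IsEF1 v B := by
      refine hE.of_improvement hle fun k => ?_
      by_cases hk : k = j
      · subst hk
        refine Or.inr ⟨g, by simp [hBj], fun i => ?_⟩
        rw [hBj, Finset.insert_sdiff_of_mem _ (Finset.mem_singleton_self g)]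
        exact (hmono i Finset.sdiff_subset).trans (hj i)
      · exact Or.inl ⟨k, hBk k hk⟩
    have := hmax B ⟨hdB, hEB, hw.trans (Finset.sum_le_sum fun i _ => hle i)⟩
    have hcard : ∑ i, (A i).card < ∑ i, (B i).card := by
      refine Finset.sum_lt_sum (fun i _ => Finset.card_le_card (hsub i)) ⟨j, Finset.mem_univ _, ?_⟩
      rw [hBj, Finset.card_insert_of_notMem (hg j)]
      exact Nat.lt_succ_self _
    rw [Prod.Lex.toLex_le_toLex] at this
    rcases this with h | h
    · exact h.not_gt hcard
    · exact hcard.ne' h.1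

/-- Dual prices of a maximum weight matching of agents to single goods. -/
lemma exists_matching_prices [Fintype ι] [Fintype α] [DecidableEq α]
    {v : ι → Finset α → ℝ} (hnn : ∀ i S, 0 ≤ v i S) :
    ∃ (Q : ι → Finset α) (p : α → ℝ), (Pairwise fun a b => Disjoint (Q a) (Q b)) ∧
      (∀ i, (Q i).card ≤ 1) ∧ (∀ g, 0 ≤ p g) ∧ ∑ g, p g ≤ ∑ i, v i (Q i) ∧
      ∀ i g, v i {g} ≤ v i (Q i) + p g := by
  classical
  obtain ⟨Q, hQ, hmax⟩ := Finset.exists_max_image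
    (Finset.univ.filter fun A : ι → Finset α => (Pairwise fun a b => Disjoint (A a) (A b)) ∧
      ∀ i, (A i).card ≤ 1)
    (fun A => ∑ i, v i (A i)) ⟨fun _ => ∅, Finset.mem_filter.2 ⟨Finset.mem_univ _, fun _ _ _ => by simp, by simp⟩⟩
  simp only [Finset.mem_filter, Finset.mem_univ, true_and] at hQ hmax
  obtain ⟨hd, hc⟩ := hQ
  refine ⟨Q, fun g => ∑ k, if g ∈ Q k then v k (Q k) else 0, hd, hc, fun g => ?_, ?_, fun i g => ?_⟩
  · exact Finset.sum_nonneg fun k _ => by split_ifs <;> simp [hnn]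
  · rw [Finset.sum_comm]
    refine Finset.sum_le_sum fun k _ => ?_
    rw [Finset.sum_ite_mem, Finset.univ_inter, Finset.sum_const, nsmul_eq_mul]
    have : ((Q k).card : ℝ) ≤ 1 := by exact_mod_cast hc k
    nlinarith [hnn k (Q k)]
  · let B : ι → Finset α := fun k => if k = i then {g} else Q k \ {g}
    have hB : ∑ k, v k (B k) ≤ ∑ k, v k (Q k) := by
      refine hmax B ⟨fun a b hab => ?_, fun k => ?_⟩
      · by_cases ha : a = i <;> by_cases hb : b = i
        · exact absurd (ha.trans hb.symm) hab
        · simp [B, ha, hb]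
        · simp [B, ha, hb]
        · simp only [B, ha, hb, if_false]
          exact (hd hab).mono Finset.sdiff_subset Finset.sdiff_subset
      · by_cases hk : k = i
        · simp [B, hk]
        · simp only [B, hk, if_false]
          exact (Finset.card_le_card Finset.sdiff_subset).trans (hc k)
    have hterm : ∀ k, v k (Q k) - (if g ∈ Q k then v k (Q k) else 0) +
        (if k = i then v i {g} - v i (Q i) else 0) ≤ v k (B k) := by
      intro k
      by_cases hk : k = i
      · subst hk
        simp only [B, if_true]
        split_ifs <;> linarith [hnn k (Q k)]
      · simp only [B, hk, if_false]
        split_ifs with h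
        · linarith [hnn k (Q k \ {g})]
        · rw [Finset.sdiff_singleton_eq_erase, Finset.erase_eq_of_notMem h]; simp
    have hsum := (Finset.sum_le_sum fun k _ => hterm k).trans hB
    rw [Finset.sum_add_distrib, Finset.sum_sub_distrib, Finset.sum_ite_eq' ] at hsum
    simp only [Finset.mem_univ, if_true] at hsum
    linarith

lemma IsEF1.apply_le_add_prices [DecidableEq α] {v : ι → Finset α → ℝ} {A : ι → Finset α}
    (hA : IsEF1 v A) (h0 : ∀ i, v i ∅ = 0) (hnn : ∀ i S, 0 ≤ v i S)
    (hsub : ∀ i A B, v i (A ∪ B) ≤ v i A + v i B) {u : ι → ℝ} {p : α → ℝ}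
    (hu : ∀ i, 0 ≤ u i) (hp : ∀ g, 0 ≤ p g) (hup : ∀ i g, v i {g} ≤ u i + p g) (i j : ι) :
    v i (A j) ≤ v i (A i) + u i + ∑ g ∈ A j, p g := by
  obtain h | h := (A j).eq_empty_or_nonempty
  · rw [h, h0, Finset.sum_empty]
    linarith [hnn i (A i), hu i]
  · obtain ⟨g, hg, hle⟩ := hA i j h
    have h1 := hsub i (A j \ {g}) {g}
    rw [Finset.sdiff_union_of_subset (Finset.singleton_subset_iff.2 hg)] at h1
    linarith [hup i g, Finset.single_le_sum (fun g _ => hp g) hg]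

/-- In a welfare-maximal EF1 allocation into segments, nobody prefers an unassigned segment to
their own bundle. -/
lemma exists_segment_allocation [Fintype ι] [Fintype α] [LinearOrder α]
    {v : ι → Finset α → ℝ} (h0 : ∀ i, v i ∅ = 0) (hnn : ∀ i S, 0 ≤ v i S)
    (W : ι → Finset α) {Q : ι → Finset α} (hQd : Pairwise fun a b => Disjoint (Q a) (Q b))
    (hQE : IsEF1 v Q) (hQs : ∀ k, ∃ j, IsSegment W j (Q k)) :
    ∃ P : ι → Finset α, (Pairwise fun a b => Disjoint (P a) (P b)) ∧ IsEF1 v P ∧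
      (∀ k, ∃ j, IsSegment W j (P k)) ∧ ∑ i, v i (Q i) ≤ ∑ i, v i (P i) ∧
      ∀ j X, IsSegment W j X → (∀ k, Disjoint X (P k)) → ∀ k, v k X ≤ v k (P k) := by
  classical
  obtain ⟨P, hP, hmax⟩ := Finset.exists_max_image
    (Finset.univ.filter fun A : ι → Finset α => (Pairwise fun a b => Disjoint (A a) (A b)) ∧
      IsEF1 v A ∧ ∀ k, ∃ j, IsSegment W j (A k))
    (fun A => ∑ i, v i (A i)) ⟨Q, by simp [hQd, hQE, hQs]⟩
  simp only [Finset.mem_filter, Finset.mem_univ, true_and] at hP hmax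
  obtain ⟨hd, hE, hs⟩ := hP
  refine ⟨P, hd, hE, hs, hmax Q ⟨hQd, hQE, hQs⟩, fun j X => ?_⟩
  induction X using Finset.induction_on_max with
  | empty => intro _ _ k; rw [h0]; exact hnn _ _
  | insert g X hg ih =>
    intro hseg hdis k
    have hXdis : ∀ k, Disjoint X (P k) := fun k =>
      (hdis k).mono_left (Finset.subset_insert _ _)
    have hXseg : IsSegment W j X := by
      refine ⟨(Finset.subset_insert _ _).trans hseg.1, fun x hx z hz y hy hxy hyz => ?_⟩
      have := hseg.2 x (Finset.mem_insert_of_mem hx) z (Finset.mem_insert_of_mem hz) y hy hxy hyz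
      exact (Finset.mem_insert.1 this).resolve_left (hyz.trans (hg z hz)).ne
    have ih := ih hXseg hXdis
    by_contra! hlt
    let B := Function.update P k (insert g X)
    have hBk : B k = insert g X := Function.update_self ..
    have hBi : ∀ i, i ≠ k → B i = P i := fun i hi => Function.update_of_ne hi ..
    have hle : ∀ i, v i (P i) ≤ v i (B i) := by
      intro i
      by_cases h : i = k
      · subst h; rw [hBk]; exact hlt.le
      · rw [hBi i h]
    have hB := hmax B ⟨?_, ?_, ?_⟩
    · refine hB.not_gt (Finset.sum_lt_sum (fun i _ => hle i) ⟨k, Finset.mem_univ _, ?_⟩)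
      rwa [hBk]
    · intro a b hab
      by_cases ha : a = k
      · subst ha
        rw [hBk, hBi b hab.symm]
        exact hdis b
      · rw [hBi a ha]
        by_cases hb : b = k
        · subst hb
          rw [hBk]
          exact (hdis a).symm
        · rw [hBi b hb]; exact hd hab
    · refine hE.of_improvement hle fun i => ?_
      by_cases h : i = k
      · subst h
        refine Or.inr ⟨g, by simp [hBk], fun l => ?_⟩
        rw [hBk, Finset.insert_sdiff_of_mem _ (Finset.mem_singleton_self g),
          Finset.sdiff_singleton_eq_erase, Finset.erase_eq_of_notMem fun h => (hg g h).false]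
        exact ih l
      · exact Or.inl ⟨i, hBi i h⟩
    · intro i
      by_cases h : i = k
      · subst h; rw [hBk]; exact ⟨j, hseg⟩
      · rw [hBi i h]; exact hs i

/-- The part of a block missed by `c` segments splits into at most `c + 1` segments. -/
lemma apply_sdiff_segments_le [DecidableEq ι] [LinearOrder α] {f : Finset α → ℝ} (h0 : f ∅ = 0)
    (hsub : ∀ A B, f (A ∪ B) ≤ f A + f B) (W : ι → Finset α) (j : ι) (K : Finset ι)
    (P : ι → Finset α) (hP : ∀ k ∈ K, IsSegment W j (P k)) {x : ℝ}
    (hx : ∀ X, IsSegment W j X → (∀ k ∈ K, Disjoint X (P k)) → f X ≤ x) :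
    f (W j \ K.biUnion P) ≤ (K.card + 1) * x := by
  classical
  let below : α → Finset ι := fun g => K.filter fun k => ∃ y ∈ P k, y < g
  have hmono : ∀ {g h}, g ≤ h → below g ⊆ below h := by
    intro g h hgh k hk
    simp only [below, Finset.mem_filter] at hk ⊢
    obtain ⟨hk, y, hy, hyg⟩ := hk
    exact ⟨hk, y, hy, hyg.trans_le hgh⟩
  let T : ℕ → Finset α := fun c => (W j \ K.biUnion P).filter fun g => (below g).card = c
  have hcover : W j \ K.biUnion P = (Finset.range (K.card + 1)).biUnion T := by
    ext g
    simp only [T, Finset.mem_biUnion, Finset.mem_filter, Finset.mem_range]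
    refine ⟨fun hg => ⟨_, Nat.lt_succ_of_le (Finset.card_filter_le _ _), hg, rfl⟩, ?_⟩
    rintro ⟨_, _, hg, _⟩
    exact hg
  have hT : ∀ c, f (T c) ≤ x := by
    intro c
    refine hx _ ⟨(Finset.filter_subset _ _).trans Finset.sdiff_subset, ?_⟩ ?_
    · intro a ha b hb y hy hay hyb
      simp only [T, Finset.mem_filter, Finset.mem_sdiff, Finset.mem_biUnion, not_exists,
        not_and] at ha hb ⊢
      have heq : below a = below b :=
        Finset.eq_of_subset_of_card_le (hmono (hay.trans hyb).le) (by omega)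
      refine ⟨⟨hy, fun k hk hyk => ?_⟩, ?_⟩
      · have hkb : k ∈ below b := Finset.mem_filter.2 ⟨hk, y, hyk, hyb⟩
        rw [← heq] at hkb
        obtain ⟨_, z, hz, hza⟩ := Finset.mem_filter.1 hkb
        exact ha.1.2 k hk ((hP k hk).2 z hz y hyk a ha.1.1 hza hay)
      · have h1 := Finset.card_le_card (hmono hay.le)
        have h2 := Finset.card_le_card (hmono hyb.le)
        omega
    · intro k hk
      rw [Finset.disjoint_left]
      intro g hg hgk
      exact (Finset.mem_sdiff.1 (Finset.mem_filter.1 hg).1).2 (Finset.mem_biUnion.2 ⟨k, hk, hgk⟩)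
  calc f (W j \ K.biUnion P) ≤ ∑ c ∈ Finset.range (K.card + 1), f (T c) := by
        rw [hcover]; exact apply_biUnion_le_sum h0 hsub _ _
    _ ≤ ∑ _c ∈ Finset.range (K.card + 1), x := Finset.sum_le_sum fun c _ => hT c
    _ = (K.card + 1) * x := by simp

/-- For every fair division instance with `n ≥ 1` agents having scaled
monotone subadditive valuations over `m` goods, there exists an EF1 allocation `B`
whose social welfare is at least `OPT / (16√n)`; equivalently, every allocation `W`
has social welfare at most `16√n` times that of `B`. Hence the price of EF1 for
scaled subadditive valuations is `O(√n)`. -/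
theorem price_of_ef1_scaled_subadditive
    (n m : ℕ) (hn : 1 ≤ n)
    (v : Fin n → Finset (Fin m) → ℝ)
    (hmono : ∀ i, ∀ A B : Finset (Fin m), A ⊆ B → v i A ≤ v i B)
    (hsub : ∀ i, ∀ A B : Finset (Fin m), v i (A ∪ B) ≤ v i A + v i B)
    (h0 : ∀ i, v i ∅ = 0)
    (hscaled : ∀ i, v i Finset.univ = 1) :
    ∃ B : Fin n → Finset (Fin m),
      (∀ a b : Fin n, a ≠ b → Disjoint (B a) (B b)) ∧
      Finset.univ.biUnion B = Finset.univ ∧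
      (∀ i j : Fin n, (B j).Nonempty → ∃ g ∈ B j, v i (B j \ {g}) ≤ v i (B i)) ∧
      (∀ W : Fin n → Finset (Fin m),
        (∀ a b : Fin n, a ≠ b → Disjoint (W a) (W b)) →
        Finset.univ.biUnion W = Finset.univ →
        ∑ i, v i (W i) ≤ 16 * Real.sqrt n * ∑ i, v i (B i)) := by
  classical
  have : Nonempty (Fin n) := ⟨⟨0, hn⟩⟩
  have hnn : ∀ i S, 0 ≤ v i S := fun i S => h0 i ▸ hmono i ∅ S (Finset.empty_subset S)
  obtain ⟨W, hW, hWmax⟩ := Finset.exists_max_image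
    (Finset.univ.filter fun A : Fin n → Finset (Fin m) =>
      (∀ a b, a ≠ b → Disjoint (A a) (A b)) ∧ Finset.univ.biUnion A = Finset.univ)
    (fun A => ∑ i, v i (A i)) (by
      refine ⟨fun i => if i = ⟨0, hn⟩ then Finset.univ else ∅, ?_⟩
      simp only [Finset.mem_filter, Finset.mem_univ, true_and]
      refine ⟨fun a b hab => ?_, ?_⟩
      · by_cases ha : a = ⟨0, hn⟩
        · simp [show b ≠ ⟨0, hn⟩ from fun h => hab (ha.trans h.symm)]
        · simp [ha]
      · ext g
        simp only [Finset.mem_biUnion, Finset.mem_univ, true_and, iff_true]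
        exact ⟨⟨0, hn⟩, by simp⟩)
  simp only [Finset.mem_filter, Finset.mem_univ, true_and] at hW hWmax
  obtain ⟨hWd, hWu⟩ := hW
  obtain ⟨Q, p, hQd, hQc, hp, hpQ, hup⟩ := exists_matching_prices hnn
  have hQE : IsEF1 v Q := by
    rintro i j ⟨g, hg⟩
    refine ⟨g, hg, ?_⟩
    have : Q j \ {g} = ∅ := by
      rw [Finset.sdiff_eq_empty_iff_subset]
      intro x hx
      exact Finset.mem_singleton.2 (Finset.card_le_one.1 (hQc j) x hx g hg)
    rw [this, h0]
    exact hnn _ _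
  have hQs : ∀ k, ∃ j, IsSegment W j (Q k) := by
    intro k
    obtain h | ⟨g, hg⟩ := (Q k).eq_empty_or_nonempty
    · exact ⟨k, by simp [IsSegment, h]⟩
    · have hgW : g ∈ Finset.univ.biUnion W := hWu ▸ Finset.mem_univ g
      obtain ⟨j, -, hj⟩ := Finset.mem_biUnion.1 hgW
      have hone := Finset.card_le_one.1 (hQc k)
      refine ⟨j, fun x hx => hone x hx g hg ▸ hj, fun x hx z hz y _ hxy hyz => ?_⟩
      exact absurd (hone x hx z hz) (hxy.trans hyz).ne
  obtain ⟨P, hPd, hPE, hPs, hQP, hPmax⟩ := exists_segment_allocation h0 hnn W hQd hQE hQs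
  obtain ⟨A, hAd, hAu, hAE, hPA⟩ :=
    hPE.exists_complete (fun i A B hAB => hmono i A B hAB) hPd
  refine ⟨A, fun a b hab => hAd hab, hAu, hAE, fun W' hW'd hW'u => ?_⟩
  refine (hWmax W' ⟨hW'd, hW'u⟩).trans ?_
  have hu : ∀ i, 0 ≤ v i (Q i) := fun i => hnn _ _
  have hn0 : (0 : ℝ) < n := by exact_mod_cast hn
  -- the welfare of `A` is bounded below by an absolute constant
  have habs : 1 ≤ 3 * ∑ i, v i (A i) := by
    have hi : ∀ i, 1 ≤ n * v i (A i) + n * v i (Q i) + ∑ g, p g := by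
      intro i
      calc (1 : ℝ) = v i (Finset.univ.biUnion A) := by rw [hAu, hscaled]
        _ ≤ ∑ j, v i (A j) := apply_biUnion_le_sum (h0 i) (hsub i) _ _
        _ ≤ ∑ j, (v i (A i) + v i (Q i) + ∑ g ∈ A j, p g) := Finset.sum_le_sum fun j _ =>
            hAE.apply_le_add_prices h0 hnn hsub hu hp hup i j
        _ = n * v i (A i) + n * v i (Q i) + ∑ g ∈ Finset.univ.biUnion A, p g := by
            rw [Finset.sum_add_distrib, Finset.sum_biUnion fun a _ b _ hab => hAd hab]
            simp only [Finset.sum_const, Finset.card_univ, Fintype.card_fin, nsmul_eq_mul]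
            ring
        _ = n * v i (A i) + n * v i (Q i) + ∑ g, p g := by rw [hAu]
    have hsum := Finset.sum_le_sum fun i (_ : i ∈ Finset.univ) => hi i
    simp only [Finset.sum_add_distrib, ← Finset.mul_sum, Finset.sum_const, Finset.card_univ,
      Fintype.card_fin, nsmul_eq_mul, mul_one] at hsum
    refine le_of_mul_le_mul_left (?_ : (n : ℝ) * 1 ≤ n * _) hn0
    nlinarith
  choose b hb using hPs
  let K : Fin n → Finset (Fin n) := fun i => Finset.univ.filter fun k => b k = i
  set r := Real.sqrt n with hr
  have hrr : r * r = n := Real.mul_self_sqrt hn0.le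
  have hr1 : 1 ≤ r := Real.one_le_sqrt.2 (by exact_mod_cast hn)
  have hW1 : ∀ i, v i (W i) ≤ ((K i).card + 1) * v i (P i) +
      ((K i).card * (v i (P i) + v i (Q i)) + ∑ k ∈ K i, ∑ g ∈ P k, p g) := by
    intro i
    have hgap : v i (W i \ (K i).biUnion P) ≤ ((K i).card + 1) * v i (P i) := by
      refine apply_sdiff_segments_le (h0 i) (hsub i) W i (K i) P ?_ fun X hX hXd => ?_
      · intro k hk
        exact (Finset.mem_filter.1 hk).2 ▸ hb k
      · refine hPmax i X hX (fun k => ?_) i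
        by_cases hk : b k = i
        · exact hXd k (Finset.mem_filter.2 ⟨Finset.mem_univ _, hk⟩)
        · exact (hWd i (b k) (Ne.symm hk)).mono hX.1 (hb k).1
    have hpieces : v i ((K i).biUnion P) ≤
        (K i).card * (v i (P i) + v i (Q i)) + ∑ k ∈ K i, ∑ g ∈ P k, p g := by
      calc v i ((K i).biUnion P) ≤ ∑ k ∈ K i, v i (P k) :=
            apply_biUnion_le_sum (h0 i) (hsub i) _ _
        _ ≤ ∑ k ∈ K i, (v i (P i) + v i (Q i) + ∑ g ∈ P k, p g) := Finset.sum_le_sum fun k _ =>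
            hPE.apply_le_add_prices h0 hnn hsub hu hp hup i k
        _ = _ := by rw [Finset.sum_add_distrib, Finset.sum_const, nsmul_eq_mul]
    have := hsub i (W i \ (K i).biUnion P) ((K i).biUnion P)
    linarith [hmono i (W i) _ (show W i ⊆ W i \ (K i).biUnion P ∪ (K i).biUnion P by
      rw [Finset.sdiff_union_self_eq_union]; exact Finset.subset_union_left)]
  -- agents whose block meets more than `√n` bundles are few
  have hW2 : ∀ i, v i (W i) ≤ (K i).card / r + (2 * r + 1) * v i (P i) + r * v i (Q i) +
      ∑ k ∈ K i, ∑ g ∈ P k, p g := by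
    intro i
    have hq : 0 ≤ ∑ k ∈ K i, ∑ g ∈ P k, p g :=
      Finset.sum_nonneg fun k _ => Finset.sum_nonneg fun g _ => hp g
    have hc0 : (0 : ℝ) ≤ (K i).card / r := by positivity
    have hx := hnn i (P i)
    have hy := hu i
    obtain h | h := le_total ((K i).card : ℝ) r
    · nlinarith [hW1 i, mul_le_mul_of_nonneg_right h hx, mul_le_mul_of_nonneg_right h hy]
    · have h1 : v i (W i) ≤ 1 := hscaled i ▸ hmono i _ _ (Finset.subset_univ _)
      have h2 : 1 ≤ (K i).card / r := by rwa [one_le_div (by linarith)]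
      have h3 : 0 ≤ (2 * r + 1) * v i (P i) := by positivity
      have h4 : 0 ≤ r * v i (Q i) := by positivity
      linarith
  have hcard : ∑ i, ((K i).card : ℝ) = n := by
    have := Finset.card_eq_sum_card_fiberwise (s := Finset.univ) (t := Finset.univ) (f := b)
      fun _ _ => by simp
    rw [Finset.card_univ, Fintype.card_fin] at this
    exact_mod_cast this.symm
  have hprice : ∑ i, ∑ k ∈ K i, ∑ g ∈ P k, p g ≤ ∑ g, p g := by
    rw [Finset.sum_fiberwise Finset.univ b fun k => ∑ g ∈ P k, p g,
      ← Finset.sum_biUnion fun a _ b _ hab => hPd hab]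
    exact Finset.sum_le_sum_of_subset_of_nonneg (Finset.subset_univ _) fun g _ _ => hp g
  have hsum := Finset.sum_le_sum fun i (_ : i ∈ Finset.univ) => hW2 i
  simp only [Finset.sum_add_distrib, ← Finset.mul_sum, ← Finset.sum_div, hcard] at hsum
  rw [← hrr, mul_self_div_self] at hsum
  have hP0 : 0 ≤ ∑ i, v i (P i) := Finset.sum_nonneg fun i _ => hnn _ _
  nlinarith
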